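/- Let 1 ≤ i, j ≤ m, a ∈ ℤ, r ∈ S, and ⌊n/2⌋ < l ≤ n, and assume either a > 0, or a = 0 and i < j. Then ( Σ_{k=1}^{n} psi_i^k(a−r) psibar_j^k(r) ) B_l |0⟩ = 0 in F_N(S). -/

import Mathlib

noncomputable section

/-- Context for the enlarged Weyl algebra `W_N(S)` with `N = m·n` and
`S = ℤ` (encoded by `sig = 0`) or `S = ℤ + 1/2` (encoded by `sig = 1`).
An element `r ∈ S` is encoded by the unique integer `k` with `r = k + sig/2`,
so that `ε := 1/2 - sig/2` and e.g. `r > 0 ↔ 0 < 2k + sig`.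
The data also fixes a generic `q ∈ ℂˣ` together with a square root `sq` of `q`. -/
structure WCtx where
  m : ℕ
  n : ℕ
  hm : 0 < m
  hn : 0 < n
  sig : ℤ
  hsig : sig = 0 ∨ sig = 1
  q : ℂ
  sq : ℂ
  hsq : sq ^ 2 = q
  hq0 : q ≠ 0
  hqu : ∀ k : ℕ, k ≠ 0 → q ^ k ≠ 1

namespace WCtx

variable (C : WCtx)

/-- `N = m n`. -/
def NN : ℕ := C.m * C.n

/-- Names of the generators of `W_N(S)`: `Sum.inl i` is `ψ_{i+1}` and
`Sum.inr i` is `ψ̄_{i+1}`; the integer `k` encodes the index `r = k + sig/2 ∈ S`. -/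
abbrev Gen : Type := (Fin C.NN ⊕ Fin C.NN) × ℤ

/-- The defining relations of the enlarged Weyl algebra `W_N(S)`:
any two `ψ`'s commute, any two `ψ̄`'s commute, and
`ψ̄_i(k)ψ_j(r) − ψ_j(r)ψ̄_i(k) = δ_{i,j} δ_{k+r,0}`. -/
inductive rel : FreeAlgebra ℂ C.Gen → FreeAlgebra ℂ C.Gen → Prop
  | comm_psi (i j : Fin C.NN) (k l : ℤ) :
      rel (FreeAlgebra.ι ℂ ((Sum.inl i, k) : C.Gen) * FreeAlgebra.ι ℂ ((Sum.inl j, l) : C.Gen))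
          (FreeAlgebra.ι ℂ ((Sum.inl j, l) : C.Gen) * FreeAlgebra.ι ℂ ((Sum.inl i, k) : C.Gen))
  | comm_psibar (i j : Fin C.NN) (k l : ℤ) :
      rel (FreeAlgebra.ι ℂ ((Sum.inr i, k) : C.Gen) * FreeAlgebra.ι ℂ ((Sum.inr j, l) : C.Gen))
          (FreeAlgebra.ι ℂ ((Sum.inr j, l) : C.Gen) * FreeAlgebra.ι ℂ ((Sum.inr i, k) : C.Gen))
  | mixed (i j : Fin C.NN) (k l : ℤ) :
      rel (FreeAlgebra.ι ℂ ((Sum.inr i, k) : C.Gen) * FreeAlgebra.ι ℂ ((Sum.inl j, l) : C.Gen))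
          (FreeAlgebra.ι ℂ ((Sum.inl j, l) : C.Gen) * FreeAlgebra.ι ℂ ((Sum.inr i, k) : C.Gen)
            + (if i = j ∧ k + l + C.sig = 0 then 1 else 0))

/-- The enlarged Weyl algebra `W_N(S)`. -/
def W : Type := RingQuot C.rel

instance : Ring C.W := inferInstanceAs (Ring (RingQuot C.rel))
instance : Algebra ℂ C.W := inferInstanceAs (Algebra ℂ (RingQuot C.rel))

/-- `ψ` with `0`-indexed flat subscript. -/
def psi0 (i : Fin C.NN) (k : ℤ) : C.W :=
  RingQuot.mkAlgHom ℂ C.rel (FreeAlgebra.ι ℂ ((Sum.inl i, k) : C.Gen))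

/-- `ψ̄` with `0`-indexed flat subscript. -/
def psibar0 (i : Fin C.NN) (k : ℤ) : C.W :=
  RingQuot.mkAlgHom ℂ C.rel (FreeAlgebra.ι ℂ ((Sum.inr i, k) : C.Gen))

/-- `ψ_i(r)` with `1`-indexed flat subscript `i ∈ {1,…,N}` (junk value `0` outside). -/
def psiF (i : ℕ) (k : ℤ) : C.W :=
  if h : 1 ≤ i ∧ i ≤ C.NN then C.psi0 ⟨i - 1, by omega⟩ k else 0

/-- `ψ̄_i(r)` with `1`-indexed flat subscript `i ∈ {1,…,N}` (junk value `0` outside). -/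
def psibarF (i : ℕ) (k : ℤ) : C.W :=
  if h : 1 ≤ i ∧ i ≤ C.NN then C.psibar0 ⟨i - 1, by omega⟩ k else 0

/-- `ψ_i^c(r) = ψ_{i+(c-1)m}(r)`, subscript `i ∈ {1,…,m}`, superscript `c ∈ {1,…,n}`. -/
def psiS (i c : ℕ) (k : ℤ) : C.W := C.psiF (i + (c - 1) * C.m) k

/-- `ψ̄_i^c(r) = ψ̄_{i+(c-1)m}(r)`. -/
def psibarS (i c : ℕ) (k : ℤ) : C.W := C.psibarF (i + (c - 1) * C.m) k

/-- The left ideal of `W_N(S)` generated by all `ψ_i(r), ψ̄_i(r)` with `r > 0`,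
together with all `ψ̄_i(0)` when `S = ℤ`. -/
def vacIdeal : Submodule C.W C.W :=
  Submodule.span C.W
    {w : C.W |
      (∃ (i : Fin C.NN) (k : ℤ), 0 < 2 * k + C.sig ∧ (w = C.psi0 i k ∨ w = C.psibar0 i k)) ∨
        (C.sig = 0 ∧ ∃ i : Fin C.NN, w = C.psibar0 i 0)}

/-- The Fock module `F_N(S) = W_N(S)/I`. -/
def F : Type := C.W ⧸ C.vacIdeal

instance : AddCommGroup C.F := inferInstanceAs (AddCommGroup (C.W ⧸ C.vacIdeal))
instance : Module C.W C.F := inferInstanceAs (Module C.W (C.W ⧸ C.vacIdeal))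
instance : Module ℂ C.F := inferInstanceAs (Module ℂ (C.W ⧸ C.vacIdeal))

/-- The vacuum vector `|0⟩ ∈ F_N(S)`. -/
def vac : C.F := Submodule.Quotient.mk (1 : C.W)

/-- Normal ordering `:u(k) v(l):` where `l` encodes the `S`-index of the second factor. -/
def nord (u : C.W) (l : ℤ) (v : C.W) : C.W :=
  if 0 < 2 * l + C.sig then u * v
  else if 2 * l + C.sig = 0 then (2 : ℂ)⁻¹ • (u * v + v * u)
  else v * u

/-- `ε = 0` if `S = ℤ + 1/2`, `ε = 1/2` if `S = ℤ`, as a complex number. -/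
def eps : ℂ := (1 - (C.sig : ℂ)) / 2

/-- `ω_S(b)`. -/
def om (b : ℤ) : ℂ :=
  if b = 0 then 0
  else if C.sig = 0 then (2 : ℂ)⁻¹ * ((C.q ^ b + 1) / (C.q ^ b - 1))
  else C.sq ^ b / (C.q ^ b - 1)

/-- `q^{-b r}` for `r = k + sig/2 ∈ S`. -/
def qp (b k : ℤ) : ℂ := C.sq ^ (-(b * (2 * k + C.sig)))

/-- `q^{b r}` for `r = k + sig/2 ∈ S`. -/
def qpp (b k : ℤ) : ℂ := C.sq ^ (b * (2 * k + C.sig))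

/-- `φ^c_{t + sig/2}`; here `t ∈ ℤ` encodes the half-integer index `t + sig/2 = t + 1/2 - ε`.
Writing `t = (k + sig)m - i` with `1 ≤ i ≤ m`, `k ∈ ℤ`, this is `ψ_i^c(k + sig/2)`. -/
def PhiW (c : ℕ) (t : ℤ) : C.W :=
  C.psiF ((((-t - 1).emod C.m).toNat + 1) + (c - 1) * C.m)
    ((t + (-t - 1).emod C.m + 1) / C.m - C.sig)

/-- `φ̄^c_{t + sig/2}`; writing `t = k·m + i - 1` with `1 ≤ i ≤ m`, `k ∈ ℤ`,
this is `ψ̄_i^c(k + sig/2)`. -/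
def PhibarW (c : ℕ) (t : ℤ) : C.W :=
  C.psibarF (((t.emod C.m).toNat + 1) + (c - 1) * C.m) ((t - t.emod C.m) / C.m)

/-- Determinant of a square matrix with (pairwise commuting) entries in `W_N(S)`. -/
def ncdet {l : ℕ} (M : Fin l → Fin l → C.W) : C.W :=
  ∑ p : Equiv.Perm (Fin l),
    (((Equiv.Perm.sign p : ℤˣ) : ℤ)) • ((List.finRange l).map fun t => M (p t) t).prod

/-- The element `A_l ∈ W_N(S)`, `1 ≤ l ≤ n`. -/
def Adet (l : ℕ) : C.W :=
  C.ncdet fun k t : Fin l => C.PhiW ((k : ℕ) + 1) (-(((t : ℕ) : ℤ) + 1))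

/-- The element `Ā_l ∈ W_N(S)`, `1 ≤ l ≤ n`. -/
def Abar (l : ℕ) : C.W :=
  C.ncdet fun s t : Fin (C.n - l + 1) => C.PhibarW (C.n - (s : ℕ)) (-(((t : ℕ) : ℤ) + 1))

/-- `α(r,a,i) = (a - r + 1/2 - ε)m - i + 1 = (a-k)m - i + 1` for `r = k + sig/2`. -/
def alphaV (k a : ℤ) (i : ℕ) : ℤ := (a - k) * C.m - (i : ℤ) + 1

/-- `β(r,a,j) = (r + a - 1/2 + ε)m + j = (k+a)m + j` for `r = k + sig/2`. -/
def betaV (k a : ℤ) (j : ℕ) : ℤ := (k + a) * C.m + (j : ℤ)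

/-- `Σ_{c=1}^{n} ψ_i^c(a-r) ψ̄_j^c(r)`, where `k` encodes `r`. -/
def Esum (i j : ℕ) (a k : ℤ) : C.W :=
  ∑ c : Fin C.n, C.psiS i ((c : ℕ) + 1) (a - k - C.sig) * C.psibarS j ((c : ℕ) + 1) k

/-- `A_l^{i,j,r}`: `A_l` with the `β(r,0,j)`-th column replaced by
`(φ^1_{α(r,a,i)-1/2-ε}, …, φ^l_{α(r,a,i)-1/2-ε})ᵗ`. -/
def Amod (l : ℕ) (i j : ℕ) (a k : ℤ) : C.W :=
  C.ncdet fun r t : Fin l =>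
    if (((t : ℕ) : ℤ) + 1) = C.betaV k 0 j then C.PhiW ((r : ℕ) + 1) (C.alphaV k a i - 1)
    else C.PhiW ((r : ℕ) + 1) (-(((t : ℕ) : ℤ) + 1))

/-- `Ā_l^{i,j,r}`: `Ā_l` with the `α(r,a,i)`-th column replaced by
`(-φ̄^n_{β(r,0,j)-1/2-ε}, …, -φ̄^l_{β(r,0,j)-1/2-ε})ᵗ`. -/
def Abarmod (l : ℕ) (i j : ℕ) (a k : ℤ) : C.W :=
  C.ncdet fun s t : Fin (C.n - l + 1) =>
    if (((t : ℕ) : ℤ) + 1) = C.alphaV k a i then -C.PhibarW (C.n - (s : ℕ)) (C.betaV k 0 j - 1)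
    else C.PhibarW (C.n - (s : ℕ)) (-(((t : ℕ) : ℤ) + 1))

/-- `l̄₁` for `l = l₁ m + l₂`, `1 ≤ l₂ ≤ m`. -/
def lb1 (l : ℕ) : ℕ :=
  if (l - 1) / C.m % 2 = 0 then ((l - 1) / C.m / 2) * C.m + ((l - 1) % C.m + 1)
  else (((l - 1) / C.m + 1) / 2) * C.m

/-- `l̄₂ = l - l̄₁`. -/
def lb2 (l : ℕ) : ℕ := l - C.lb1 l

/-- The `(k,t)` entry of the matrix defining `B_l`. -/
def Bentry (l : ℕ) (k t : Fin l) : C.W :=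
  if (t : ℕ) + 1 ≤ C.lb1 l then C.PhiW ((k : ℕ) + 1) (-(((t : ℕ) : ℤ) + 1))
  else C.PhibarW (C.n - (k : ℕ)) (-((((t : ℕ) : ℤ) + 1) - (C.lb1 l : ℤ)))

/-- The element `B_l ∈ W_N(S)`, `1 ≤ l ≤ n`. -/
def Bdet (l : ℕ) : C.W := C.ncdet (C.Bentry l)

/-- The element `B̄_{n/2} ∈ W_N(S)` (`n` even): `B_{n/2}` with its `(n/2)`-th row replaced. -/
def Bbar : C.W :=
  C.ncdet fun k t : Fin (C.n / 2) =>
    if (k : ℕ) + 1 = C.n / 2 then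
      (if (t : ℕ) + 1 ≤ C.lb1 (C.n / 2) then C.PhiW (C.n / 2 + 1) (-(((t : ℕ) : ℤ) + 1))
       else C.PhibarW (C.n / 2) (-((((t : ℕ) : ℤ) + 1) - (C.lb1 (C.n / 2) : ℤ))))
    else C.Bentry (C.n / 2) k t

/-- `B_l` with its `pos`-th column replaced by the column `(col 1, …, col l)ᵗ`. -/
def Bcolrep (l : ℕ) (pos : ℤ) (col : ℕ → C.W) : C.W :=
  C.ncdet fun k t : Fin l =>
    if (((t : ℕ) : ℤ) + 1) = pos then col ((k : ℕ) + 1) else C.Bentry l k t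

/-- The operator `T_{i,j}(a,b) = Σ_{r∈S} q^{-br} Σ_{c=1}^n :ψ_i^c(a-r) ψ̄_j^c(r):`. -/
def Top (i j : ℕ) (a b : ℤ) (x : C.F) : C.F :=
  ∑ᶠ k : ℤ, (C.qp b k • ∑ c : Fin C.n,
    C.nord (C.psiS i ((c : ℕ) + 1) (a - k - C.sig)) k (C.psibarS j ((c : ℕ) + 1) k)) • x

/-- The operator `S_{i,j}(c,d) = Σ_{e=1}^n ψ_i^e(c) ψ̄_j^e(d)`. -/
def Sop (i j : ℕ) (c d : ℤ) (x : C.F) : C.F :=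
  (∑ e : Fin C.n, C.psiS i ((e : ℕ) + 1) c * C.psibarS j ((e : ℕ) + 1) d) • x

/-- The operator `E_{p,p} = Σ_{c=1}^m Σ_{r∈S} :ψ_c^p(-r) ψ̄_c^p(r): − ε m`. -/
def Epp (p : ℕ) (x : C.F) : C.F :=
  (∑ᶠ k : ℤ, (∑ c : Fin C.m,
      C.nord (C.psiS ((c : ℕ) + 1) p (-k - C.sig)) k (C.psibarS ((c : ℕ) + 1) p k)) • x)
    - (C.eps * (C.m : ℂ)) • x

/-- The operator `E_i(b) = Σ_{r∈S} q^{-br} Σ_{c=1}^n :ψ_i^c(-r) ψ̄_i^c(r): − n ω_S(b)`. -/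
def Eib (i : ℕ) (b : ℤ) (x : C.F) : C.F :=
  (∑ᶠ k : ℤ, (C.qp b k • ∑ c : Fin C.n,
      C.nord (C.psiS i ((c : ℕ) + 1) (-k - C.sig)) k (C.psibarS i ((c : ℕ) + 1) k)) • x)
    - ((C.n : ℂ) * C.om b) • x

/-- `Σ_{r ∈ J^S_{i,l}} q^{-br}`. -/
def Jsum (i l : ℕ) (b : ℤ) : ℂ :=
  ∑ᶠ k ∈ {k : ℤ | 1 ≤ k * (C.m : ℤ) + (i : ℤ) ∧ k * (C.m : ℤ) + (i : ℤ) ≤ (l : ℤ)}, C.qp b k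

/-- `Σ_{r ∈ J̄^S_{i,l}} q^{-br}`. -/
def Jbarsum (i l : ℕ) (b : ℤ) : ℂ :=
  ∑ᶠ k ∈ {k : ℤ | 1 ≤ -(k * (C.m : ℤ)) - (i : ℤ) + 1 ∧ -(k * (C.m : ℤ)) - (i : ℤ) + 1 ≤ (l : ℤ)},
    C.qp b k

/-- `Σ_{r ∈ J^S_{i,l}} q^{br}`. -/
def JsumP (i l : ℕ) (b : ℤ) : ℂ :=
  ∑ᶠ k ∈ {k : ℤ | 1 ≤ k * (C.m : ℤ) + (i : ℤ) ∧ k * (C.m : ℤ) + (i : ℤ) ≤ (l : ℤ)}, C.qpp b k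

/-- `Σ_{c=1}^m ψ_c^p(-r) ψ̄_c^{p+1}(r)` (no normal ordering), `k` encoding `r ∈ S`. -/
def glRaise (p : ℕ) (k : ℤ) : C.W :=
  ∑ c : Fin C.m, C.psiS ((c : ℕ) + 1) p (-k - C.sig) * C.psibarS ((c : ℕ) + 1) (p + 1) k

/-- The operator `Σ_{c=1}^m Σ_{r∈S} :ψ_c^p(-r) ψ̄_c^{p+1}(r):`. -/
def glRaiseOp (p : ℕ) (x : C.F) : C.F :=
  ∑ᶠ k : ℤ, (∑ c : Fin C.m,
    C.nord (C.psiS ((c : ℕ) + 1) p (-k - C.sig)) k (C.psibarS ((c : ℕ) + 1) (p + 1) k)) • x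

end WCtx

namespace WCtx

variable (C : WCtx)

section Generators

theorem psi0_comm (i j : Fin C.NN) (k l : ℤ) :
    Commute (C.psi0 i k) (C.psi0 j l) := by
  have h := RingQuot.mkAlgHom_rel ℂ (rel.comm_psi (C := C) i j k l)
  rw [map_mul, map_mul] at h
  exact h

theorem psibar0_comm (i j : Fin C.NN) (k l : ℤ) :
    Commute (C.psibar0 i k) (C.psibar0 j l) := by
  have h := RingQuot.mkAlgHom_rel ℂ (rel.comm_psibar (C := C) i j k l)
  rw [map_mul, map_mul] at h
  exact h

theorem psibar0_mul_psi0 (i j : Fin C.NN) (k l : ℤ) :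
    C.psibar0 i k * C.psi0 j l =
      C.psi0 j l * C.psibar0 i k + (if i = j ∧ k + l + C.sig = 0 then 1 else 0) := by
  have h := RingQuot.mkAlgHom_rel ℂ (rel.mixed (C := C) i j k l)
  rw [map_add, map_mul, map_mul, apply_ite (RingQuot.mkAlgHom ℂ C.rel), map_one, map_zero] at h
  exact h

theorem flat_le {x c : ℕ} (hx : x < C.m) (hc : 1 ≤ c) (hc' : c ≤ C.n) :
    1 ≤ x + 1 + (c - 1) * C.m ∧ x + 1 + (c - 1) * C.m ≤ C.NN := by
  obtain ⟨d, rfl⟩ : ∃ d, c = d + 1 := ⟨c - 1, by omega⟩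
  have h : (d + 1) * C.m ≤ C.n * C.m := Nat.mul_le_mul_right _ hc'
  simp only [NN, Nat.add_sub_cancel]
  constructor
  · omega
  · nlinarith

theorem flat_inj {x y c d : ℕ} (hx : x < C.m) (hy : y < C.m) (hc : 1 ≤ c) (hd : 1 ≤ d) :
    x + 1 + (c - 1) * C.m = y + 1 + (d - 1) * C.m ↔ x = y ∧ c = d := by
  constructor
  · intro h
    have h' : x + C.m * (c - 1) = y + C.m * (d - 1) := by
      rw [mul_comm C.m, mul_comm C.m]; omega
    have h1 := congrArg (· % C.m) h'
    have h2 := congrArg (· / C.m) h'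
    simp only [Nat.add_mul_mod_self_left, Nat.mod_eq_of_lt hx, Nat.mod_eq_of_lt hy] at h1
    simp only [Nat.add_mul_div_left _ _ C.hm, Nat.div_eq_of_lt hx, Nat.div_eq_of_lt hy] at h2
    omega
  · rintro ⟨rfl, rfl⟩; rfl

theorem toNat_emod_lt (u : ℤ) : (u % (C.m : ℤ)).toNat < C.m := by
  have hm : (0 : ℤ) < C.m := by exact_mod_cast C.hm
  have := Int.emod_lt_of_pos u hm
  have := Int.emod_nonneg u hm.ne'
  omega

theorem PhiW_eq {c : ℕ} (hc : 1 ≤ c) (hc' : c ≤ C.n) (t : ℤ) :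
    C.PhiW c t = C.psi0 ⟨((-t - 1) % (C.m : ℤ)).toNat + 1 + (c - 1) * C.m - 1, by
      have := C.flat_le (C.toNat_emod_lt (-t - 1)) hc hc'; omega⟩
      (-((-t - 1) / (C.m : ℤ)) - C.sig) := by
  have hm : (C.m : ℤ) ≠ 0 := by exact_mod_cast C.hm.ne'
  have hq : (t + (-t - 1).emod C.m + 1) / (C.m : ℤ) = -((-t - 1) / (C.m : ℤ)) := by
    have h := Int.emod_add_mul_ediv (-t - 1) C.m
    have h' : t + (-t - 1).emod C.m + 1 = C.m * -((-t - 1) / (C.m : ℤ)) := by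
      change t + (-t - 1) % (C.m : ℤ) + 1 = _
      linarith
    rw [h', Int.mul_ediv_cancel_left _ hm]
  rw [PhiW, hq, psiF]
  exact dif_pos (C.flat_le (C.toNat_emod_lt (-t - 1)) hc hc')

theorem PhibarW_eq {c : ℕ} (hc : 1 ≤ c) (hc' : c ≤ C.n) (t : ℤ) :
    C.PhibarW c t = C.psibar0 ⟨(t % (C.m : ℤ)).toNat + 1 + (c - 1) * C.m - 1, by
      have := C.flat_le (C.toNat_emod_lt t) hc hc'; omega⟩ (t / (C.m : ℤ)) := by
  have hm : (C.m : ℤ) ≠ 0 := by exact_mod_cast C.hm.ne'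
  have hq : (t - t.emod C.m) / (C.m : ℤ) = t / (C.m : ℤ) := by
    have h := Int.emod_add_mul_ediv t C.m
    have h' : t - t.emod C.m = C.m * (t / (C.m : ℤ)) := by
      change t - t % (C.m : ℤ) = _
      linarith
    rw [h', Int.mul_ediv_cancel_left _ hm]
  rw [PhibarW, hq, psibarF]
  exact dif_pos (C.flat_le (C.toNat_emod_lt t) hc hc')

theorem PhiW_comm {c d : ℕ} (hc : 1 ≤ c) (hc' : c ≤ C.n) (hd : 1 ≤ d) (hd' : d ≤ C.n)
    (s t : ℤ) : Commute (C.PhiW c s) (C.PhiW d t) := by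
  rw [C.PhiW_eq hc hc', C.PhiW_eq hd hd']
  exact C.psi0_comm _ _ _ _

theorem PhibarW_comm {c d : ℕ} (hc : 1 ≤ c) (hc' : c ≤ C.n) (hd : 1 ≤ d) (hd' : d ≤ C.n)
    (s t : ℤ) : Commute (C.PhibarW c s) (C.PhibarW d t) := by
  rw [C.PhibarW_eq hc hc', C.PhibarW_eq hd hd']
  exact C.psibar0_comm _ _ _ _

theorem PhibarW_mul_PhiW {c d : ℕ} (hc : 1 ≤ c) (hc' : c ≤ C.n) (hd : 1 ≤ d) (hd' : d ≤ C.n)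
    (s t : ℤ) :
    C.PhibarW c s * C.PhiW d t =
      C.PhiW d t * C.PhibarW c s + (if c = d ∧ s + t + 1 = 0 then 1 else 0) := by
  rw [C.PhibarW_eq hc hc', C.PhiW_eq hd hd', psibar0_mul_psi0]
  congr 1
  refine if_congr ?_ rfl rfl
  have hm : (0 : ℤ) < C.m := by exact_mod_cast C.hm
  have hs := Int.emod_nonneg s hm.ne'
  have ht := Int.emod_nonneg (-t - 1) hm.ne'
  have e₁ := Int.emod_add_mul_ediv s C.m
  have e₂ := Int.emod_add_mul_ediv (-t - 1) C.m
  have hflat := C.flat_inj (C.toNat_emod_lt s) (C.toNat_emod_lt (-t - 1)) hc hd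
  rw [Fin.mk.injEq]
  constructor
  · rintro ⟨h₁, h₂⟩
    obtain ⟨h₃, h₄⟩ := hflat.1 (by omega)
    have h₅ : s % (C.m : ℤ) = (-t - 1) % (C.m : ℤ) := by omega
    have h₆ : s / (C.m : ℤ) = (-t - 1) / (C.m : ℤ) := by omega
    rw [h₅, h₆] at e₁
    exact ⟨h₄, by linarith⟩
  · rintro ⟨rfl, h⟩
    have : s = -t - 1 := by omega
    subst this
    exact ⟨rfl, by ring⟩

theorem PhibarW_comm_PhiW {c d : ℕ} (hc : 1 ≤ c) (hc' : c ≤ C.n) (hd : 1 ≤ d) (hd' : d ≤ C.n)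
    {s t : ℤ} (h : ¬ (c = d ∧ s + t + 1 = 0)) : Commute (C.PhibarW c s) (C.PhiW d t) := by
  rw [Commute, SemiconjBy, C.PhibarW_mul_PhiW hc hc' hd hd', if_neg h, add_zero]

theorem smul_vac_of_mem {w : C.W} (hw : w ∈ C.vacIdeal) : w • C.vac = 0 := by
  have h : w • C.vac = (Submodule.Quotient.mk (w * 1) : C.W ⧸ C.vacIdeal) := rfl
  rw [h, mul_one]
  exact (Submodule.Quotient.mk_eq_zero _).2 hw

theorem PhiW_smul_vac {c : ℕ} (hc : 1 ≤ c) (hc' : c ≤ C.n) {t : ℤ} (ht : 0 ≤ t) :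
    C.PhiW c t • C.vac = 0 := by
  have hm : (0 : ℤ) < C.m := by exact_mod_cast C.hm
  have h : (-t - 1) / (C.m : ℤ) < 0 := Int.ediv_neg_of_neg_of_pos (by omega) hm
  rw [C.PhiW_eq hc hc']
  refine C.smul_vac_of_mem (Submodule.subset_span (Or.inl ⟨_, _, ?_, Or.inl rfl⟩))
  rcases C.hsig with h' | h' <;> rw [h'] <;> omega

theorem PhibarW_smul_vac {c : ℕ} (hc : 1 ≤ c) (hc' : c ≤ C.n) {t : ℤ} (ht : 0 ≤ t) :
    C.PhibarW c t • C.vac = 0 := by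
  have hm : (0 : ℤ) < C.m := by exact_mod_cast C.hm
  have h : 0 ≤ t / (C.m : ℤ) := Int.ediv_nonneg ht hm.le
  rw [C.PhibarW_eq hc hc']
  refine C.smul_vac_of_mem (Submodule.subset_span ?_)
  by_cases h₀ : 0 < 2 * (t / (C.m : ℤ)) + C.sig
  · exact Or.inl ⟨_, _, h₀, Or.inr rfl⟩
  · rcases C.hsig with h' | h' <;> rw [h'] at h₀
    · have : t / (C.m : ℤ) = 0 := by omega
      exact Or.inr ⟨h', _, by rw [this]⟩
    · omega

theorem psiS_eq_PhiW {i : ℕ} (hi : 1 ≤ i) (hi' : i ≤ C.m) (c : ℕ) (a k : ℤ) :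
    C.psiS i c (a - k - C.sig) = C.PhiW c ((a - k) * C.m - i) := by
  have hm : (0 : ℤ) < C.m := by exact_mod_cast C.hm
  have hu : -((a - k) * C.m - (i : ℤ)) - 1 = ((i : ℤ) - 1) + C.m * (k - a) := by ring
  have hr : (-((a - k) * C.m - (i : ℤ)) - 1).emod C.m = (i : ℤ) - 1 := by
    change (-((a - k) * C.m - (i : ℤ)) - 1) % (C.m : ℤ) = _
    rw [hu, Int.add_mul_emod_self_left, Int.emod_eq_of_lt (by omega) (by omega)]
  have hq : ((a - k) * C.m - (i : ℤ) + ((i : ℤ) - 1) + 1) / (C.m : ℤ) = a - k := by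
    rw [show (a - k) * C.m - (i : ℤ) + ((i : ℤ) - 1) + 1 = (a - k) * C.m by ring,
      Int.mul_ediv_cancel _ hm.ne']
  rw [psiS, PhiW, hr, hq, show ((i : ℤ) - 1).toNat + 1 = i by omega]

theorem psibarS_eq_PhibarW {j : ℕ} (hj : 1 ≤ j) (hj' : j ≤ C.m) (c : ℕ) (k : ℤ) :
    C.psibarS j c k = C.PhibarW c (k * C.m + j - 1) := by
  have hm : (0 : ℤ) < C.m := by exact_mod_cast C.hm
  have hr : (k * C.m + (j : ℤ) - 1).emod C.m = (j : ℤ) - 1 := by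
    change (k * C.m + (j : ℤ) - 1) % (C.m : ℤ) = _
    rw [show k * C.m + (j : ℤ) - 1 = ((j : ℤ) - 1) + C.m * k by ring,
      Int.add_mul_emod_self_left, Int.emod_eq_of_lt (by omega) (by omega)]
  have hq : (k * C.m + (j : ℤ) - 1 - ((j : ℤ) - 1)) / (C.m : ℤ) = k := by
    rw [show k * C.m + (j : ℤ) - 1 - ((j : ℤ) - 1) = k * C.m by ring,
      Int.mul_ediv_cancel _ hm.ne']
  rw [psibarS, PhibarW, hr, hq, show ((j : ℤ) - 1).toNat + 1 = j by omega]

end Generators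

section ListProducts

variable {R ι : Type*} [Ring R]

theorem commute_list_prod {X : R} {f : ι → R} {L : List ι} (h : ∀ t ∈ L, Commute X (f t)) :
    Commute X (L.map f).prod :=
  Commute.list_prod_right _ _ fun y hy => by
    obtain ⟨t, ht, rfl⟩ := List.mem_map.1 hy
    exact h t ht

theorem map_update_of_notMem {α β : Type*} [DecidableEq α] {f : α → β} {b : α} {L : List α}
    (hb : b ∉ L) (w : β) : L.map (Function.update f b w) = L.map f :=
  List.map_congr_left fun _ ht => Function.update_of_ne (ne_of_mem_of_not_mem ht hb) _ _

theorem mul_list_prod_eq_add [DecidableEq ι] {X z : R} {f : ι → R} {t₀ : ι} {L : List ι} (hL : L.Nodup)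
    (ht₀ : t₀ ∈ L) (h : ∀ t, t ≠ t₀ → Commute X (f t)) (h₀ : X * f t₀ = f t₀ * X + z) :
    X * (L.map f).prod = (L.map f).prod * X + (L.map (Function.update f t₀ z)).prod := by
  induction L with
  | nil => simp at ht₀
  | cons b L ih =>
    obtain ⟨hb, hL'⟩ := List.nodup_cons.1 hL
    simp only [List.map_cons, List.prod_cons]
    by_cases hbt : b = t₀
    · subst hbt
      have hc : Commute X (L.map f).prod :=
        commute_list_prod fun t ht => h t (ne_of_mem_of_not_mem ht hb)
      rw [map_update_of_notMem hb, Function.update_self, ← mul_assoc, h₀, add_mul, mul_assoc, hc.eq, mul_assoc]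
    · have ht : t₀ ∈ L := (List.mem_cons.1 ht₀).resolve_left fun e => hbt e.symm
      rw [Function.update_of_ne hbt, ← mul_assoc, (h b hbt).eq, mul_assoc, ih hL' ht, mul_add,
        mul_assoc]

theorem mul_list_prod_update [DecidableEq ι] {Y z : R} {f : ι → R} {t₀ : ι} {L : List ι} (hL : L.Nodup)
    (ht₀ : t₀ ∈ L) (h : ∀ t, t ≠ t₀ → Commute Y (f t)) :
    Y * (L.map (Function.update f t₀ z)).prod =
      (L.map (Function.update f t₀ (Y * z))).prod := by
  induction L with
  | nil => simp at ht₀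
  | cons b L ih =>
    obtain ⟨hb, hL'⟩ := List.nodup_cons.1 hL
    simp only [List.map_cons, List.prod_cons]
    by_cases hbt : b = t₀
    · subst hbt
      simp only [map_update_of_notMem hb, Function.update_self, mul_assoc]
    · have ht : t₀ ∈ L := (List.mem_cons.1 ht₀).resolve_left fun e => hbt e.symm
      rw [Function.update_of_ne hbt, Function.update_of_ne hbt, ← mul_assoc, (h b hbt).eq,
        mul_assoc, ih hL' ht]

theorem list_prod_update_sum [DecidableEq ι] {κ : Type*} (s : Finset κ) (z : κ → R) {f : ι → R} {t₀ : ι}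
    {L : List ι} (hL : L.Nodup) (ht₀ : t₀ ∈ L) :
    (L.map (Function.update f t₀ (∑ c ∈ s, z c))).prod =
      ∑ c ∈ s, (L.map (Function.update f t₀ (z c))).prod := by
  induction L with
  | nil => simp at ht₀
  | cons b L ih =>
    obtain ⟨hb, hL'⟩ := List.nodup_cons.1 hL
    simp only [List.map_cons, List.prod_cons]
    by_cases hbt : b = t₀
    · subst hbt
      simp only [map_update_of_notMem hb, Function.update_self, Finset.sum_mul]
    · have ht : t₀ ∈ L := (List.mem_cons.1 ht₀).resolve_left fun e => hbt e.symm
      simp only [Function.update_of_ne hbt, ih hL' ht, Finset.mul_sum]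

end ListProducts

section Determinant

variable {C} {l : ℕ}

/-- The matrix `M` with its column `t₀` replaced by `v`. -/
def repCol (M : Fin l → Fin l → C.W) (t₀ : Fin l) (v : Fin l → C.W) : Fin l → Fin l → C.W :=
  fun r => Function.update (M r) t₀ (v r)

theorem repCol_self (M : Fin l → Fin l → C.W) (t₀ : Fin l) (v : Fin l → C.W) (r : Fin l) :
    repCol M t₀ v r t₀ = v r :=
  Function.update_self _ _ _

theorem repCol_of_ne (M : Fin l → Fin l → C.W) {t₀ t : Fin l} (h : t ≠ t₀) (v : Fin l → C.W)
    (r : Fin l) : repCol M t₀ v r t = M r t :=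
  Function.update_of_ne h _ _

theorem repCol_diag (M : Fin l → Fin l → C.W) (t₀ : Fin l) (v : Fin l → C.W)
    (p : Equiv.Perm (Fin l)) :
    (fun t => repCol M t₀ v (p t) t) = Function.update (fun t => M (p t) t) t₀ (v (p t₀)) := by
  funext t
  by_cases h : t = t₀
  · subst h; simp [repCol]
  · simp [repCol, h]

theorem commute_ncdet {X : C.W} {M : Fin l → Fin l → C.W} (h : ∀ r t, Commute X (M r t)) :
    Commute X (C.ncdet M) :=
  Commute.sum_right _ _ _ fun p _ => by
    rw [Commute, SemiconjBy, mul_smul_comm, smul_mul_assoc,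
      (commute_list_prod (f := fun t => M (p t) t) fun t _ => h _ _).eq]

theorem mul_ncdet_eq_add {X : C.W} {M : Fin l → Fin l → C.W} {t₀ : Fin l} {z : Fin l → C.W}
    (h : ∀ r t, t ≠ t₀ → Commute X (M r t)) (h₀ : ∀ r, X * M r t₀ = M r t₀ * X + z r) :
    X * C.ncdet M = C.ncdet M * X + C.ncdet (repCol M t₀ z) := by
  simp only [ncdet, Finset.mul_sum, Finset.sum_mul, ← Finset.sum_add_distrib, repCol_diag]
  refine Finset.sum_congr rfl fun p _ => ?_
  rw [mul_smul_comm, smul_mul_assoc, ← smul_add,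
    mul_list_prod_eq_add (List.nodup_finRange l) (List.mem_finRange t₀)
      (fun t ht => h (p t) t ht) (h₀ (p t₀))]

theorem mul_ncdet_repCol {Y : C.W} {M : Fin l → Fin l → C.W} {t₀ : Fin l} {z : Fin l → C.W}
    (h : ∀ r t, t ≠ t₀ → Commute Y (M r t)) :
    Y * C.ncdet (repCol M t₀ z) = C.ncdet (repCol M t₀ fun r => Y * z r) := by
  simp only [ncdet, Finset.mul_sum, repCol_diag]
  refine Finset.sum_congr rfl fun p _ => ?_
  rw [mul_smul_comm, mul_list_prod_update (List.nodup_finRange l) (List.mem_finRange t₀)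
      (fun t ht => h (p t) t ht)]

theorem sum_ncdet_repCol {κ : Type*} (s : Finset κ) (M : Fin l → Fin l → C.W) (t₀ : Fin l)
    (z : κ → Fin l → C.W) :
    ∑ c ∈ s, C.ncdet (repCol M t₀ (z c)) = C.ncdet (repCol M t₀ fun r => ∑ c ∈ s, z c r) := by
  simp only [ncdet, repCol_diag]
  rw [Finset.sum_comm]
  refine Finset.sum_congr rfl fun p _ => ?_
  rw [list_prod_update_sum s _ (List.nodup_finRange l) (List.mem_finRange t₀), Finset.smul_sum]

theorem ncdet_swap {M : Fin l → Fin l → C.W} (hM : ∀ r t r' t', Commute (M r t) (M r' t'))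
    {t₀ t₁ : Fin l} (h : t₀ ≠ t₁) :
    C.ncdet (fun r t => M r (Equiv.swap t₀ t₁ t)) = -C.ncdet M := by
  rw [ncdet, ncdet, ← Finset.sum_neg_distrib]
  refine Fintype.sum_equiv (Equiv.mulRight (Equiv.swap t₀ t₁)) _ _ fun p => ?_
  have hp : ((List.finRange l).map fun t => M (p t) (Equiv.swap t₀ t₁ t)).prod =
      ((List.finRange l).map fun t => M ((p * Equiv.swap t₀ t₁) t) t).prod := by
    have hfun : (fun t => M (p t) (Equiv.swap t₀ t₁ t)) =
        (fun t => M ((p * Equiv.swap t₀ t₁) t) t) ∘ Equiv.swap t₀ t₁ := by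
      funext t; simp
    rw [hfun, ← List.map_map]
    refine List.Perm.prod_eq' ((Equiv.Perm.map_finRange_perm _).map _) ?_
    exact List.pairwise_of_forall_mem_list fun x hx y hy => by
      obtain ⟨t, -, rfl⟩ := List.mem_map.1 hx
      obtain ⟨t', -, rfl⟩ := List.mem_map.1 hy
      exact hM _ _ _ _
  rw [hp, Equiv.coe_mulRight, Equiv.Perm.sign_mul, Equiv.Perm.sign_swap h]
  simp

theorem eq_zero_of_eq_neg {w : C.W} (h : w = -w) : w = 0 := by
  have h₂ : (2 : ℂ) • w = 0 := by
    rw [two_smul]; nth_rewrite 2 [h]; exact add_neg_cancel w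
  simpa using h₂

theorem ncdet_eq_zero_of_col_eq {M : Fin l → Fin l → C.W}
    (hM : ∀ r t r' t', Commute (M r t) (M r' t')) {t₀ t₁ : Fin l} (h : t₀ ≠ t₁)
    (hcol : ∀ r, M r t₀ = M r t₁) : C.ncdet M = 0 := by
  refine eq_zero_of_eq_neg ?_
  rw [← ncdet_swap hM h]
  congr 1
  funext r t
  by_cases h₀ : t = t₀
  · rw [h₀, Equiv.swap_apply_left, hcol]
  · by_cases h₁ : t = t₁
    · rw [h₁, Equiv.swap_apply_right, hcol]
    · rw [Equiv.swap_apply_of_ne_of_ne h₀ h₁]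

theorem commute_repCol {M : Fin l → Fin l → C.W} (hM : ∀ r t r' t', Commute (M r t) (M r' t'))
    {t₀ : Fin l} {v : Fin l → C.W} (hv : ∀ r r' t', Commute (v r) (M r' t'))
    (hvv : ∀ r r', Commute (v r) (v r')) (r t r' t' : Fin l) :
    Commute (repCol M t₀ v r t) (repCol M t₀ v r' t') := by
  by_cases h : t = t₀ <;> by_cases h' : t' = t₀
  · subst h; subst h'; rw [repCol_self, repCol_self]; exact hvv _ _
  · subst h; rw [repCol_self, repCol_of_ne _ h']; exact hv _ _ _
  · subst h'; rw [repCol_self, repCol_of_ne _ h]; exact (hv _ _ _).symm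
  · rw [repCol_of_ne _ h, repCol_of_ne _ h']; exact hM _ _ _ _

end Determinant

section Bdet

variable {C} {l : ℕ}

theorem Bentry_of_lt {t : Fin l} (ht : (t : ℕ) < C.lb1 l) (r : Fin l) :
    C.Bentry l r t = C.PhiW (r + 1) (-((t : ℕ) : ℤ) - 1) := by
  rw [Bentry, if_pos (by omega), neg_add']

theorem Bentry_of_le {t : Fin l} (ht : C.lb1 l ≤ (t : ℕ)) (r : Fin l) :
    C.Bentry l r t = C.PhibarW (C.n - r) ((C.lb1 l : ℤ) - (t : ℕ) - 1) := by
  rw [Bentry, if_neg (by omega)]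
  congr 1
  ring

theorem PhibarW_comm_Bentry (hl : l ≤ C.n) {c : ℕ} (hc : 1 ≤ c) (hc' : c ≤ C.n) {s : ℤ}
    (r t : Fin l) (h : ¬ ((t : ℕ) < C.lb1 l ∧ ((t : ℕ) : ℤ) = s)) :
    Commute (C.PhibarW c s) (C.Bentry l r t) := by
  have hr := r.2
  by_cases ht : (t : ℕ) < C.lb1 l
  · rw [Bentry_of_lt ht]
    exact C.PhibarW_comm_PhiW hc hc' (by omega) (by omega) (by omega)
  · rw [Bentry_of_le (not_lt.1 ht)]
    exact C.PhibarW_comm hc hc' (by omega) (by omega) _ _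

theorem PhiW_comm_Bentry (hl : l ≤ C.n) {c : ℕ} (hc : 1 ≤ c) (hc' : c ≤ C.n) {s : ℤ}
    (r t : Fin l) (h : ¬ (C.lb1 l ≤ (t : ℕ) ∧ ((t : ℕ) : ℤ) = C.lb1 l + s)) :
    Commute (C.PhiW c s) (C.Bentry l r t) := by
  have hr := r.2
  by_cases ht : (t : ℕ) < C.lb1 l
  · rw [Bentry_of_lt ht]
    exact C.PhiW_comm hc hc' (by omega) (by omega) _ _
  · rw [Bentry_of_le (not_lt.1 ht)]
    exact (C.PhibarW_comm_PhiW (by omega) (by omega) hc hc' (by omega)).symm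

theorem Bentry_comm (hl : l ≤ C.n) (r t r' t' : Fin l) :
    Commute (C.Bentry l r t) (C.Bentry l r' t') := by
  have hr := r.2
  by_cases ht : (t : ℕ) < C.lb1 l
  · rw [Bentry_of_lt ht]
    exact PhiW_comm_Bentry hl (by omega) (by omega) _ _ (by omega)
  · rw [Bentry_of_le (not_lt.1 ht)]
    exact PhibarW_comm_Bentry hl (by omega) (by omega) _ _ (by omega)

theorem PhibarW_mul_Bentry (hl : l ≤ C.n) {c : ℕ} (hc : c < C.n) {s : ℤ} {t : Fin l}
    (ht : (t : ℕ) < C.lb1 l) (hts : ((t : ℕ) : ℤ) = s) (r : Fin l) :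
    C.PhibarW (c + 1) s * C.Bentry l r t =
      C.Bentry l r t * C.PhibarW (c + 1) s + if (r : ℕ) = c then 1 else 0 := by
  have hr := r.2
  rw [Bentry_of_lt ht, C.PhibarW_mul_PhiW (by omega) (by omega) (by omega) (by omega)]
  congr 1
  exact if_congr (by omega) rfl rfl

theorem neg_PhiW_mul_Bentry (hl : l ≤ C.n) {c : ℕ} (hc : c < C.n) {s : ℤ} {t : Fin l}
    (ht : C.lb1 l ≤ (t : ℕ)) (hts : ((t : ℕ) : ℤ) = C.lb1 l + s) (r : Fin l) :
    -C.PhiW (c + 1) s * C.Bentry l r t =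
      C.Bentry l r t * -C.PhiW (c + 1) s + if (r : ℕ) + c + 1 = C.n then 1 else 0 := by
  have hr := r.2
  have h := C.PhibarW_mul_PhiW (c := C.n - r) (d := c + 1) (by omega) (by omega) (by omega)
    (by omega) ((C.lb1 l : ℤ) - (t : ℕ) - 1) s
  have hiff : C.n - r = c + 1 ∧ (C.lb1 l : ℤ) - (t : ℕ) - 1 + s + 1 = 0 ↔
      (r : ℕ) + c + 1 = C.n := by omega
  simp only [hiff] at h
  rw [Bentry_of_le ht, mul_neg, h, neg_mul]
  abel

/-- The column `(δ_{r,c})_r`. -/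
def unitCol (C : WCtx) (l c : ℕ) : Fin l → C.W := fun r => if (r : ℕ) = c then 1 else 0

/-- The column `(δ_{r, n-1-c})_r`. -/
def revUnitCol (C : WCtx) (l c : ℕ) : Fin l → C.W :=
  fun r => if (r : ℕ) + c + 1 = C.n then 1 else 0

theorem commute_ite (x : C.W) (P : Prop) [Decidable P] :
    Commute x (if P then 1 else 0) := by
  split_ifs
  · exact Commute.one_right x
  · exact Commute.zero_right x

theorem PhibarW_mul_Bdet_smul_vac (hl : l ≤ C.n) {c : ℕ} (hc : c < C.n) {t₀ : Fin l}
    (ht₀ : (t₀ : ℕ) < C.lb1 l) :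
    (C.PhibarW (c + 1) (t₀ : ℕ) * C.Bdet l) • C.vac =
      C.ncdet (repCol (C.Bentry l) t₀ (unitCol C l c)) • C.vac := by
  rw [Bdet, mul_ncdet_eq_add (t₀ := t₀) (z := unitCol C l c), add_smul, mul_smul,
    C.PhibarW_smul_vac (by omega) (by omega) (by omega), smul_zero, zero_add]
  · intro r t ht
    exact PhibarW_comm_Bentry hl (by omega) (by omega) _ _
      fun h => ht (Fin.ext (by exact_mod_cast h.2))
  · exact PhibarW_mul_Bentry hl hc ht₀ rfl

theorem neg_PhiW_mul_Bdet_smul_vac (hl : l ≤ C.n) {c : ℕ} (hc : c < C.n) {p : ℤ} (hp : 0 ≤ p)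
    {t₁ : Fin l} (ht₁ : ((t₁ : ℕ) : ℤ) = C.lb1 l + p) :
    (-C.PhiW (c + 1) p * C.Bdet l) • C.vac =
      C.ncdet (repCol (C.Bentry l) t₁ (revUnitCol C l c)) • C.vac := by
  rw [Bdet, mul_ncdet_eq_add (t₀ := t₁) (z := revUnitCol C l c), add_smul, mul_smul, neg_smul,
    C.PhiW_smul_vac (by omega) (by omega) hp, neg_zero, smul_zero, zero_add]
  · intro r t ht
    exact (PhiW_comm_Bentry hl (by omega) (by omega) _ _
      fun h => ht (Fin.ext (by omega))).neg_left
  · exact neg_PhiW_mul_Bentry hl hc (by omega) ht₁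

theorem neg_PhiW_mul_ncdet_repCol_smul_vac (hl : l ≤ C.n) {c : ℕ} (hc : c < C.n) {p : ℤ}
    (hp : 0 ≤ p) {t₀ t₁ : Fin l} (ht₀ : (t₀ : ℕ) < C.lb1 l)
    (ht₁ : ((t₁ : ℕ) : ℤ) = C.lb1 l + p) :
    (-C.PhiW (c + 1) p * C.ncdet (repCol (C.Bentry l) t₀ (unitCol C l c))) • C.vac =
      C.ncdet (repCol (repCol (C.Bentry l) t₀ (unitCol C l c)) t₁ (revUnitCol C l c)) •
        C.vac := by
  have hne : t₁ ≠ t₀ := fun h => by subst h; omega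
  rw [mul_ncdet_eq_add (t₀ := t₁) (z := revUnitCol C l c), add_smul, mul_smul, neg_smul,
    C.PhiW_smul_vac (by omega) (by omega) hp, neg_zero, smul_zero, zero_add]
  · intro r t ht
    by_cases h₀ : t = t₀
    · rw [h₀, repCol_self]
      exact commute_ite _ _
    · rw [repCol_of_ne _ h₀]
      exact (PhiW_comm_Bentry hl (by omega) (by omega) _ _
        fun h => ht (Fin.ext (by omega))).neg_left
  · intro r
    rw [repCol_of_ne _ hne]
    exact neg_PhiW_mul_Bentry hl hc (by omega) ht₁ r

theorem sum_ncdet_unitCol_revUnitCol (hl : l ≤ C.n) {t₀ t₁ : Fin l} (h : t₀ ≠ t₁) :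
    ∑ c : Fin C.n, C.ncdet (repCol (repCol (C.Bentry l) t₀ (unitCol C l c)) t₁
      (revUnitCol C l c)) = 0 := by
  refine eq_zero_of_eq_neg ?_
  rw [← Finset.sum_neg_distrib]
  refine Fintype.sum_equiv Fin.revPerm _ _ fun c => ?_
  rw [← ncdet_swap (t₀ := t₀) (t₁ := t₁) ?_ h]
  · congr 1
    funext r t
    have hr := r.2
    have hc := c.2
    by_cases h₀ : t = t₀
    · rw [h₀, Equiv.swap_apply_left, repCol_of_ne _ h, repCol_self, repCol_self]
      exact if_congr (by rw [Fin.revPerm_apply, Fin.val_rev]; omega) rfl rfl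
    · by_cases h₁ : t = t₁
      · rw [h₁, Equiv.swap_apply_right, repCol_self, repCol_of_ne _ h, repCol_self]
        exact if_congr (by rw [Fin.revPerm_apply, Fin.val_rev]; omega) rfl rfl
      · rw [Equiv.swap_apply_of_ne_of_ne h₀ h₁, repCol_of_ne _ h₁, repCol_of_ne _ h₀,
          repCol_of_ne _ h₁, repCol_of_ne _ h₀]
  · have hcomm (x : C.W) (d : ℕ) (r : Fin l) : Commute (unitCol C l d r) x :=
      (commute_ite x _).symm
    have hcomm' (x : C.W) (d : ℕ) (r : Fin l) : Commute (revUnitCol C l d r) x :=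
      (commute_ite x _).symm
    exact commute_repCol (commute_repCol (Bentry_comm hl) (fun _ _ _ => hcomm _ _ _)
      fun _ _ => hcomm _ _ _) (fun _ _ _ => hcomm' _ _ _) fun _ _ => hcomm' _ _ _

theorem sum_PhiW_mul_unitCol (hl : l ≤ C.n) {p : ℤ} (hp : p < 0) {t₀ : Fin l}
    (ht₀ : (t₀ : ℕ) < C.lb1 l) (hpt : 0 ≤ p + (t₀ : ℕ)) :
    ∑ c : Fin C.n, C.PhiW (c + 1) p * C.ncdet (repCol (C.Bentry l) t₀ (unitCol C l c)) = 0 := by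
  have hcol (r : Fin l) :
      ∑ c : Fin C.n, C.PhiW (c + 1) p * unitCol C l c r = C.PhiW (r + 1) p := by
    rw [Finset.sum_eq_single ⟨r, r.2.trans_le hl⟩]
    · simp [unitCol]
    · intro c _ hc
      rw [unitCol, if_neg fun h => hc (Fin.ext h.symm), mul_zero]
    · simp
  have hmul (c : Fin C.n) :
      C.PhiW (c + 1) p * C.ncdet (repCol (C.Bentry l) t₀ (unitCol C l c)) =
        C.ncdet (repCol (C.Bentry l) t₀ fun r => C.PhiW (c + 1) p * unitCol C l c r) :=
    mul_ncdet_repCol fun r t _ => PhiW_comm_Bentry hl (by omega) (by omega) _ _ (by omega)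
  have ht₀l := t₀.2
  let t₁ : Fin l := ⟨(-p - 1).toNat, by omega⟩
  have ht₁ : ((t₁ : ℕ) : ℤ) = -p - 1 := Int.toNat_of_nonneg (by omega)
  have hne : t₁ ≠ t₀ := fun h => by rw [h] at ht₁; omega
  simp only [hmul, sum_ncdet_repCol, hcol]
  refine ncdet_eq_zero_of_col_eq (commute_repCol (Bentry_comm hl) ?_ ?_) hne ?_
  · exact fun r r' t' => PhiW_comm_Bentry hl (by omega) (by omega) _ _ (by omega)
  · exact fun r r' => C.PhiW_comm (by omega) (by omega) (by omega) (by omega) _ _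
  · intro r
    rw [repCol_of_ne _ hne, repCol_self, Bentry_of_lt (by omega), ht₁]
    congr 1
    ring

theorem sum_PhibarW_mul_revUnitCol (hl : l ≤ C.n) {p s : ℤ} (hs : s < 0) (hps : 0 ≤ p + s)
    {t₁ : Fin l} (ht₁ : ((t₁ : ℕ) : ℤ) = C.lb1 l + p) :
    ∑ c : Fin C.n,
      C.PhibarW (c + 1) s * C.ncdet (repCol (C.Bentry l) t₁ (revUnitCol C l c)) = 0 := by
  have hcol (r : Fin l) :
      ∑ c : Fin C.n, C.PhibarW (c + 1) s * revUnitCol C l c r = C.PhibarW (C.n - r) s := by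
    have hr := r.2
    rw [Finset.sum_eq_single ⟨C.n - 1 - r, by omega⟩]
    · rw [revUnitCol, if_pos (by simp only; omega), mul_one]
      congr 1
      simp only
      omega
    · intro c _ hc
      rw [revUnitCol, if_neg fun h => hc (Fin.ext (by simp only; omega)), mul_zero]
    · simp
  have hmul (c : Fin C.n) :
      C.PhibarW (c + 1) s * C.ncdet (repCol (C.Bentry l) t₁ (revUnitCol C l c)) =
        C.ncdet (repCol (C.Bentry l) t₁ fun r => C.PhibarW (c + 1) s * revUnitCol C l c r) :=
    mul_ncdet_repCol fun r t _ => PhibarW_comm_Bentry hl (by omega) (by omega) _ _ (by omega)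
  have ht₁l := t₁.2
  let t₀ : Fin l := ⟨(C.lb1 l - s - 1).toNat, by omega⟩
  have ht₀ : ((t₀ : ℕ) : ℤ) = C.lb1 l - s - 1 := Int.toNat_of_nonneg (by omega)
  have hne : t₀ ≠ t₁ := fun h => by rw [h] at ht₀; omega
  simp only [hmul, sum_ncdet_repCol, hcol]
  refine ncdet_eq_zero_of_col_eq (commute_repCol (Bentry_comm hl) ?_ ?_) hne ?_
  · exact fun r r' t' => PhibarW_comm_Bentry hl (by omega) (by omega) _ _ (by omega)
  · exact fun r r' => C.PhibarW_comm (by omega) (by omega) (by omega) (by omega) _ _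
  · intro r
    rw [repCol_of_ne _ hne, repCol_self, Bentry_of_le (by omega), ht₀]
    congr 1
    ring

theorem sum_PhiW_PhibarW_Bdet_smul_vac (hl : l ≤ C.n) {p s : ℤ} (hps : 0 ≤ p + s) :
    ((∑ c : Fin C.n, C.PhiW (c + 1) p * C.PhibarW (c + 1) s) * C.Bdet l) • C.vac = 0 := by
  have hcomm (c : Fin C.n) : C.PhiW (c + 1) p * C.PhibarW (c + 1) s =
      C.PhibarW (c + 1) s * C.PhiW (c + 1) p :=
    (C.PhibarW_comm_PhiW (by omega) (by omega) (by omega) (by omega) (by omega)).eq.symm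
  have hneg (c : Fin C.n) (x : C.W) : C.PhiW (c + 1) p * x = -(-C.PhiW (c + 1) p * x) := by
    rw [neg_mul, neg_neg]
  rw [Finset.sum_mul, Finset.sum_smul]
  by_cases hs : 0 ≤ s ∧ ¬ (s < C.lb1 l ∧ s < l)
  · refine Finset.sum_eq_zero fun c _ => ?_
    have h : Commute (C.PhibarW (c + 1) s) (C.Bdet l) :=
      commute_ncdet fun r t => PhibarW_comm_Bentry hl (by omega) (by omega) _ _ (by omega)
    rw [mul_assoc, h.eq, mul_smul, mul_smul,
      C.PhibarW_smul_vac (by omega) (by omega) hs.1, smul_zero, smul_zero]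
  by_cases hp : 0 ≤ p ∧ ¬ (C.lb1 l + p < l)
  · refine Finset.sum_eq_zero fun c _ => ?_
    have h : Commute (C.PhiW (c + 1) p) (C.Bdet l) :=
      commute_ncdet fun r t => PhiW_comm_Bentry hl (by omega) (by omega) _ _ (by omega)
    rw [hcomm, mul_assoc, h.eq, mul_smul, mul_smul,
      C.PhiW_smul_vac (by omega) (by omega) hp.1, smul_zero, smul_zero]
  by_cases hs₀ : 0 ≤ s
  · lift s to ℕ using hs₀
    let t₀ : Fin l := ⟨s, by omega⟩
    have ht₀ : (t₀ : ℕ) < C.lb1 l := by change s < _; omega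
    have hterm (c : Fin C.n) :
        (C.PhiW (c + 1) p * C.PhibarW (c + 1) s * C.Bdet l) • C.vac =
          (C.PhiW (c + 1) p * C.ncdet (repCol (C.Bentry l) t₀ (unitCol C l c))) • C.vac := by
      rw [mul_assoc, mul_smul, PhibarW_mul_Bdet_smul_vac (t₀ := t₀) hl c.2 ht₀, mul_smul]
    simp only [hterm]
    by_cases hp₀ : 0 ≤ p
    · let t₁ : Fin l := ⟨(C.lb1 l + p).toNat, by omega⟩
      have ht₁ : ((t₁ : ℕ) : ℤ) = C.lb1 l + p := Int.toNat_of_nonneg (by omega)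
      have hne : t₀ ≠ t₁ := fun h => by rw [← h] at ht₁; omega
      have hterm' (c : Fin C.n) :=
        neg_PhiW_mul_ncdet_repCol_smul_vac hl c.2 hp₀ ht₀ ht₁
      simp only [hneg, neg_smul (_ * _), hterm', Finset.sum_neg_distrib]
      rw [← Finset.sum_smul, sum_ncdet_unitCol_revUnitCol hl hne, zero_smul, neg_zero]
    · rw [← Finset.sum_smul, sum_PhiW_mul_unitCol hl (not_le.1 hp₀) ht₀ hps, zero_smul]
  · let t₁ : Fin l := ⟨(C.lb1 l + p).toNat, by omega⟩
    have ht₁ : ((t₁ : ℕ) : ℤ) = C.lb1 l + p := Int.toNat_of_nonneg (by omega)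
    have hterm (c : Fin C.n) :
        (C.PhiW (c + 1) p * C.PhibarW (c + 1) s * C.Bdet l) • C.vac =
          -((C.PhibarW (c + 1) s * C.ncdet (repCol (C.Bentry l) t₁ (revUnitCol C l c))) •
            C.vac) := by
      rw [hcomm, mul_assoc, hneg, mul_smul, neg_smul,
        neg_PhiW_mul_Bdet_smul_vac hl c.2 (by omega) ht₁, smul_neg, mul_smul]
    simp only [hterm, Finset.sum_neg_distrib]
    rw [← Finset.sum_smul, sum_PhibarW_mul_revUnitCol hl (not_le.1 hs₀) hps ht₁, zero_smul,
      neg_zero]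

end Bdet

end WCtx

open WCtx in
/-- **Lemma 5.13.**  For `1 ≤ i,j ≤ m`, `a ∈ ℤ`, `r ∈ S` (encoded by `k`) and
`⌊n/2⌋ < l ≤ n`, with `a > 0`, or `a = 0` and `i < j`, one has
`(Σ_{c=1}^n ψ_i^c(a-r) ψ̄_j^c(r)) B_l |0⟩ = 0` in `F_N(S)`. -/
theorem statement14 (C : WCtx) (i j : ℕ) (hi : 1 ≤ i) (hi' : i ≤ C.m)
    (hj : 1 ≤ j) (hj' : j ≤ C.m) (a k : ℤ) (l : ℕ) (hl : C.n / 2 < l) (hl' : l ≤ C.n)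
    (ha : 0 < a ∨ (a = 0 ∧ i < j)) :
    (C.Esum i j a k * C.Bdet l) • C.vac = 0 := by
  have hp : 0 ≤ ((a - k) * C.m - (i : ℤ)) + (k * C.m + j - 1) := by
    have h : ((a - k) * C.m - (i : ℤ)) + (k * C.m + j - 1) = a * C.m - i + j - 1 := by ring
    rw [h]
    rcases ha with ha | ⟨rfl, hij⟩
    · have : (C.m : ℤ) ≤ a * C.m := le_mul_of_one_le_left (by positivity) (by omega)
      omega
    · omega
  simp only [Esum, C.psiS_eq_PhiW hi hi', C.psibarS_eq_PhibarW hj hj']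
  exact sum_PhiW_PhibarW_Bdet_smul_vac hl' hp
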